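/- For all x, y ∈ A: ⟨ĥ, ȷ^{-1} g_L^{-1} g_R^{-1} x⟩ = ⟨ĥ, x ȷ^{-1} g_L^{-1} g_R^{-1}⟩; moreover the functional ω ∈ A* defined by ⟨ω, x⟩ := ⟨ĥ, ȷ^{-1} g_L^{-1} g_R^{-1} x⟩ is tracial, i.e. ⟨ω, x y⟩ = ⟨ω, y x⟩ for all x, y ∈ A. -/

import Mathlib

open scoped TensorProduct

noncomputable section

/-- An element of a `C*`-algebra is positive iff it is of the form `star y * y`. -/
def IsPosElem {A : Type*} [Mul A] [Star A] (x : A) : Prop := ∃ y : A, x = star y * y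

section Helpers

variable {A : Type*} [NormedRing A] [StarRing A] [CStarRing A]
  [NormedAlgebra ℂ A] [StarModule ℂ A]

/-- Apply a linear functional to the first leg of a tensor (`⟨φ, u₁⟩ u₂`). -/
def lapp (φ : A →ₗ[ℂ] ℂ) : A ⊗[ℂ] A →ₗ[ℂ] A :=
  (TensorProduct.lid ℂ A).toLinearMap ∘ₗ TensorProduct.map φ LinearMap.id

/-- Apply a linear functional to the second leg of a tensor (`⟨φ, u₂⟩ u₁`). -/
def rapp (φ : A →ₗ[ℂ] ℂ) : A ⊗[ℂ] A →ₗ[ℂ] A :=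
  (TensorProduct.rid ℂ A).toLinearMap ∘ₗ TensorProduct.map LinearMap.id φ

/-- Apply a pair of linear functionals to the two legs of a tensor (`⟨φ, u₁⟩⟨ψ, u₂⟩`). -/
def papp (φ ψ : A →ₗ[ℂ] ℂ) : A ⊗[ℂ] A →ₗ[ℂ] ℂ :=
  (TensorProduct.lid ℂ ℂ).toLinearMap ∘ₗ TensorProduct.map φ ψ

end Helpers

/-- A `C*`-weak Hopf algebra: a finite-dimensional unital `C*`-algebra `A` equipped with a
comultiplication `Δ` (written in Sweedler notation `Δ x = x₍₁₎ ⊗ x₍₂₎`), counit `ε` and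
antipode `S`, satisfying the axioms of Böhm–Szlachányi.  The field `starT` is the
(componentwise) star operation on `A ⊗[ℂ] A`, characterized by additivity and its values on
pure tensors. -/
structure WeakHopfData (A : Type*) [NormedRing A] [StarRing A] [CStarRing A]
    [NormedAlgebra ℂ A] [StarModule ℂ A] [FiniteDimensional ℂ A] : Type _ where
  Δ : A →ₗ[ℂ] A ⊗[ℂ] A
  ε : A →ₗ[ℂ] ℂ
  S : A ≃ₗ[ℂ] A
  starT : A ⊗[ℂ] A → A ⊗[ℂ] A
  starT_add : ∀ u v : A ⊗[ℂ] A, starT (u + v) = starT u + starT v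
  starT_tmul : ∀ a b : A, starT (a ⊗ₜ[ℂ] b) = star a ⊗ₜ[ℂ] star b
  /-- coassociativity of the comultiplication -/
  coassoc : (TensorProduct.assoc ℂ A A A).toLinearMap ∘ₗ
      (TensorProduct.map Δ LinearMap.id) ∘ₗ Δ = (TensorProduct.map LinearMap.id Δ) ∘ₗ Δ
  /-- counit axiom, left version -/
  counit_left : (TensorProduct.lid ℂ A).toLinearMap ∘ₗ (TensorProduct.map ε LinearMap.id) ∘ₗ Δ
      = LinearMap.id
  /-- counit axiom, right version -/
  counit_right : (TensorProduct.rid ℂ A).toLinearMap ∘ₗ (TensorProduct.map LinearMap.id ε) ∘ₗ Δ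
      = LinearMap.id
  /-- the comultiplication is multiplicative -/
  Δ_mul : ∀ x y : A, Δ (x * y) = Δ x * Δ y
  /-- the star operation is comultiplicative -/
  Δ_star : ∀ x : A, Δ (star x) = starT (Δ x)
  /-- the unit is weakly comultiplicative:
  `(Δ ⊗ id)(Δ 1) = (Δ 1 ⊗ 1)(1 ⊗ Δ 1)` -/
  Δ_one_weak : (TensorProduct.map Δ LinearMap.id) (Δ 1)
      = (Δ 1 ⊗ₜ[ℂ] (1 : A)) * ((TensorProduct.assoc ℂ A A A).symm ((1 : A) ⊗ₜ[ℂ] Δ 1))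
  /-- the unit is weakly comultiplicative:
  `(Δ ⊗ id)(Δ 1) = (1 ⊗ Δ 1)(Δ 1 ⊗ 1)` -/
  Δ_one_weak' : (TensorProduct.map Δ LinearMap.id) (Δ 1)
      = ((TensorProduct.assoc ℂ A A A).symm ((1 : A) ⊗ₜ[ℂ] Δ 1)) * (Δ 1 ⊗ₜ[ℂ] (1 : A))
  /-- the counit is weakly multiplicative: `ε (x y z) = ε (x y₍₁₎) ε (y₍₂₎ z)` -/
  ε_weak : ∀ x y z : A,
      ε (x * y * z) = papp (ε ∘ₗ LinearMap.mulLeft ℂ x) (ε ∘ₗ LinearMap.mulRight ℂ z) (Δ y)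
  /-- the counit is weakly multiplicative: `ε (x y z) = ε (x y₍₂₎) ε (y₍₁₎ z)` -/
  ε_weak' : ∀ x y z : A,
      ε (x * y * z) = papp (ε ∘ₗ LinearMap.mulRight ℂ z) (ε ∘ₗ LinearMap.mulLeft ℂ x) (Δ y)
  /-- antipode axiom: `x₍₁₎ S(x₍₂₎) = ε (1₍₁₎ x) 1₍₂₎` -/
  antipode_left : ∀ x : A,
      LinearMap.mul' ℂ A ((TensorProduct.map LinearMap.id S.toLinearMap) (Δ x))
        = lapp (ε ∘ₗ LinearMap.mulRight ℂ x) (Δ 1)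
  /-- antipode axiom: `S(x₍₁₎) x₍₂₎ = 1₍₁₎ ε (x 1₍₂₎)` -/
  antipode_right : ∀ x : A,
      LinearMap.mul' ℂ A ((TensorProduct.map S.toLinearMap LinearMap.id) (Δ x))
        = rapp (ε ∘ₗ LinearMap.mulLeft ℂ x) (Δ 1)
  /-- the antipode is antimultiplicative -/
  S_antimul : ∀ x y : A, S (x * y) = S y * S x
  /-- the antipode is anticomultiplicative -/
  S_anticomul : ∀ x : A,
      Δ (S x) = (TensorProduct.comm ℂ A A) ((TensorProduct.map S.toLinearMap S.toLinearMap) (Δ x))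

namespace WeakHopfData

variable {A : Type*} [NormedRing A] [StarRing A] [CStarRing A]
  [NormedAlgebra ℂ A] [StarModule ℂ A] [FiniteDimensional ℂ A]

/-- The source counital map `ε^L (x) = x₍₁₎ S(x₍₂₎)`. -/
def εL (W : WeakHopfData A) : A →ₗ[ℂ] A :=
  LinearMap.mul' ℂ A ∘ₗ TensorProduct.map LinearMap.id W.S.toLinearMap ∘ₗ W.Δ

/-- The target counital map `ε^R (x) = S(x₍₁₎) x₍₂₎`. -/
def εR (W : WeakHopfData A) : A →ₗ[ℂ] A :=
  LinearMap.mul' ℂ A ∘ₗ TensorProduct.map W.S.toLinearMap LinearMap.id ∘ₗ W.Δ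

/-- Full contraction of the iterated coproduct `Δ⁽ⁿ⁾ x = x₍₁₎ ⊗ ⋯ ⊗ x₍ₙ₊₁₎` against a family
of `n+1` linear functionals: `sweedlerEval W n φ x = ⟨φ 0, x₍₁₎⟩ ⋯ ⟨φ n, x₍ₙ₊₁₎⟩`.
Since linear functionals separate the points of a tensor power, identities between iterated
coproducts are faithfully expressed through these contractions. -/
def sweedlerEval (W : WeakHopfData A) : (n : ℕ) → (Fin (n + 1) → (A →ₗ[ℂ] ℂ)) → (A →ₗ[ℂ] ℂ)
  | 0, φ => φ 0
  | n + 1, φ => papp (sweedlerEval W n (Fin.init φ)) (φ (Fin.last (n + 1))) ∘ₗ W.Δ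

end WeakHopfData

/-- A `C*`-weak Hopf algebra together with its canonical distinguished elements:
the Haar integral `h`, the dual Haar integral `hHat`, the square roots `gL`, `gR` of
`E^L h`, `E^R h` (whence the canonical grouplike element `g = gL * gR⁻¹`), real powers
`gLpow`, `gRpow` of `gL` and `gR`, and a positive square root operation `sqrt`;
all characterized by the (uniquely determining) properties listed as fields. -/
structure HaarPkg (A : Type*) [NormedRing A] [StarRing A] [CStarRing A]
    [NormedAlgebra ℂ A] [StarModule ℂ A] [FiniteDimensional ℂ A] : Type _ where
  W : WeakHopfData A
  /-- the Haar integral -/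
  h : A
  haar_left : ∀ x : A, x * h = WeakHopfData.εL W x * h
  haar_right : ∀ x : A, h * x = h * WeakHopfData.εR W x
  haar_counitL : WeakHopfData.εL W h = 1
  haar_counitR : WeakHopfData.εR W h = 1
  haar_idem : h * h = h
  haar_star : star h = h
  haar_S : W.S h = h
  haar_nondeg : ∀ y : A, ∃ φ ψ : A →ₗ[ℂ] ℂ, lapp φ (W.Δ h) = y ∧ rapp ψ (W.Δ h) = y
  /-- the Haar integral of the dual weak Hopf algebra `A*`, as a linear functional on `A` -/
  hHat : A →ₗ[ℂ] ℂ
  hHat_pos : ∀ x : A, ∃ r : ℝ, 0 ≤ r ∧ hHat (star x * x) = (r : ℂ)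
  hHat_S : ∀ x : A, hHat (W.S x) = hHat x
  /-- `gL = (E^L h)^{1/2}` -/
  gL : A
  /-- `gR = (E^R h)^{1/2}` -/
  gR : A
  gL_pos : IsPosElem gL
  gR_pos : IsPosElem gR
  gL_unit : IsUnit gL
  gR_unit : IsUnit gR
  gL_sq : gL * gL = rapp hHat (W.Δ h)
  gR_sq : gR * gR = lapp hHat (W.Δ h)
  gL_mem : gL ∈ Set.range (WeakHopfData.εL W)
  gR_mem : gR ∈ Set.range (WeakHopfData.εR W)
  gR_S : gR = W.S gL
  gLR_comm : gL * gR = gR * gL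
  /-- the canonical grouplike element `g = gL * gR⁻¹` is positive -/
  g_pos : IsPosElem (gL * Ring.inverse gR)
  g_unit : IsUnit (gL * Ring.inverse gR)
  /-- `Δ g = (g ⊗ g) Δ 1` -/
  g_grouplike : W.Δ (gL * Ring.inverse gR)
      = ((gL * Ring.inverse gR) ⊗ₜ[ℂ] (gL * Ring.inverse gR)) * W.Δ 1
  /-- `Δ g = Δ 1 (g ⊗ g)` -/
  g_grouplike' : W.Δ (gL * Ring.inverse gR)
      = W.Δ 1 * ((gL * Ring.inverse gR) ⊗ₜ[ℂ] (gL * Ring.inverse gR))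
  /-- `S g = g⁻¹` -/
  g_S : W.S (gL * Ring.inverse gR) = Ring.inverse (gL * Ring.inverse gR)
  /-- `S² x = g x g⁻¹` -/
  S_sq : ∀ x : A,
      W.S (W.S x) = (gL * Ring.inverse gR) * x * Ring.inverse (gL * Ring.inverse gR)
  /-- `h₍₁₎ ⊗ g h₍₂₎ g = h₍₂₎ ⊗ h₍₁₎` -/
  haar_flip : TensorProduct.map LinearMap.id
      (LinearMap.mulLeft ℂ (gL * Ring.inverse gR) ∘ₗ LinearMap.mulRight ℂ (gL * Ring.inverse gR))
      (W.Δ h) = (TensorProduct.comm ℂ A A) (W.Δ h)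
  /-- dual integral relation `⟨ĥ, x (h gL⁻²)⟩ = ε x` -/
  hHat_dual₁ : ∀ x : A, hHat (x * (h * (Ring.inverse gL * Ring.inverse gL))) = W.ε x
  /-- dual integral relation `⟨ĥ, (gR⁻² h) x⟩ = ε x` -/
  hHat_dual₂ : ∀ x : A, hHat ((Ring.inverse gR * Ring.inverse gR * h) * x) = W.ε x
  /-- dual integral relation `⟨ĥ, (h gL⁻²)₍₂₎⟩ (h gL⁻²)₍₁₎ = 1` -/
  hHat_dual₃ : rapp hHat (W.Δ (h * (Ring.inverse gL * Ring.inverse gL))) = 1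
  /-- dual integral relation `⟨ĥ, (gR⁻² h)₍₁₎⟩ (gR⁻² h)₍₂₎ = 1` -/
  hHat_dual₄ : lapp hHat (W.Δ (Ring.inverse gR * Ring.inverse gR * h)) = 1
  /-- the positive square root, via the continuous functional calculus -/
  sqrt : A → A
  sqrt_pos : ∀ x : A, IsPosElem x → IsPosElem (sqrt x)
  sqrt_mul_self : ∀ x : A, IsPosElem x → sqrt x * sqrt x = x
  /-- real powers of `gL`, via the continuous functional calculus -/
  gLpow : ℝ → A
  /-- real powers of `gR`, via the continuous functional calculus -/
  gRpow : ℝ → A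
  gLpow_one : gLpow 1 = gL
  gRpow_one : gRpow 1 = gR
  gLpow_zero : gLpow 0 = 1
  gRpow_zero : gRpow 0 = 1
  gLpow_add : ∀ s t : ℝ, gLpow (s + t) = gLpow s * gLpow t
  gRpow_add : ∀ s t : ℝ, gRpow (s + t) = gRpow s * gRpow t
  gLpow_pos : ∀ t : ℝ, IsPosElem (gLpow t)
  gRpow_pos : ∀ t : ℝ, IsPosElem (gRpow t)
  gLpow_continuous : Continuous gLpow
  gRpow_continuous : Continuous gRpow

namespace HaarPkg

variable {A : Type*} [NormedRing A] [StarRing A] [CStarRing A]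
  [NormedAlgebra ℂ A] [StarModule ℂ A] [FiniteDimensional ℂ A]
variable (P : HaarPkg A)

/-- The canonical grouplike element `g = gL gR⁻¹`. -/
def g : A := P.gL * Ring.inverse P.gR

/-- The Watatani index `ı = ε^L (h gL⁻²)` of the Haar conditional expectations. -/
def iotaEl : A := WeakHopfData.εL P.W (P.h * (Ring.inverse P.gL * Ring.inverse P.gL))

/-- The element `ȷ = ⟨ĥ, (gL⁻²)₍₁₎⟩ (gL⁻²)₍₂₎`, the dual analogue of the Watatani index. -/
def jayEl : A := lapp P.hHat (P.W.Δ (Ring.inverse P.gL * Ring.inverse P.gL))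

/-- The pulling-through element `Ω = ı⁻¹ gL⁻¹ h gL⁻¹`. -/
def Ω : A := Ring.inverse P.iotaEl * Ring.inverse P.gL * P.h * Ring.inverse P.gL

/-- The map `J x = g^{-1/2} S(x) g^{1/2}`, as a linear map. -/
def Jlin : A →ₗ[ℂ] A :=
  LinearMap.mulRight ℂ (P.sqrt P.g) ∘ₗ
    LinearMap.mulLeft ℂ (Ring.inverse (P.sqrt P.g)) ∘ₗ P.W.S.toLinearMap

/-- The functional `⟨ω, x⟩ = ⟨ĥ, ȷ⁻¹ gL⁻¹ gR⁻¹ x⟩` (the dual analogue of `Ω`). -/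
def ω : A →ₗ[ℂ] ℂ :=
  P.hHat ∘ₗ LinearMap.mulLeft ℂ (Ring.inverse P.jayEl * (Ring.inverse P.gL * Ring.inverse P.gR))

/-- `ξ_L = ı^{1/2} ȷ^{1/2} gL`. -/
def ξL : A := P.sqrt P.iotaEl * P.sqrt P.jayEl * P.gL

/-- `ξ_R = ı^{1/2} ȷ^{1/2} gR`. -/
def ξR : A := P.sqrt P.iotaEl * P.sqrt P.jayEl * P.gR

/-- `ξ = ξ_L ξ_R`. -/
def ξ : A := P.ξL * P.ξR

/-- `J^L x = gL⁻¹ S(x) gL`. -/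
def JL : A → A := fun x => Ring.inverse P.gL * P.W.S x * P.gL

/-- `J^R x = gL S⁻¹(x) gL⁻¹`. -/
def JR : A → A := fun x => P.gL * P.W.S.symm x * Ring.inverse P.gL

end HaarPkg

section TensorFunctionals

variable {A : Type*} [NormedRing A] [NormedAlgebra ℂ A]

@[simp]
lemma lapp_tmul (φ : A →ₗ[ℂ] ℂ) (a b : A) : lapp φ (a ⊗ₜ[ℂ] b) = φ a • b := by
  simp [lapp]

@[simp]
lemma rapp_tmul (φ : A →ₗ[ℂ] ℂ) (a b : A) : rapp φ (a ⊗ₜ[ℂ] b) = φ b • a := by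
  simp [rapp]

lemma apply_rapp_eq_apply_lapp (φ ψ : A →ₗ[ℂ] ℂ) (u : A ⊗[ℂ] A) :
    φ (rapp ψ u) = ψ (lapp φ u) := by
  induction u using TensorProduct.induction_on with
  | zero => simp
  | tmul a b => simp [mul_comm]
  | add u v hu hv => simp [hu, hv]

lemma lapp_one_tmul_mul (φ : A →ₗ[ℂ] ℂ) (x : A) (u : A ⊗[ℂ] A) :
    lapp φ (((1 : A) ⊗ₜ[ℂ] x) * u) = x * lapp φ u := by
  induction u using TensorProduct.induction_on with
  | zero => simp
  | tmul a b => simp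
  | add u v hu hv => simp [mul_add, hu, hv]

lemma lapp_mul_one_tmul (φ : A →ₗ[ℂ] ℂ) (x : A) (u : A ⊗[ℂ] A) :
    lapp φ (u * ((1 : A) ⊗ₜ[ℂ] x)) = lapp φ u * x := by
  induction u using TensorProduct.induction_on with
  | zero => simp
  | tmul a b => simp
  | add u v hu hv => simp [add_mul, hu, hv]

lemma lapp_tmul_one_mul (φ : A →ₗ[ℂ] ℂ) (x : A) (u : A ⊗[ℂ] A) :
    lapp φ ((x ⊗ₜ[ℂ] (1 : A)) * u) = lapp (φ ∘ₗ LinearMap.mulLeft ℂ x) u := by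
  induction u using TensorProduct.induction_on with
  | zero => simp
  | tmul a b => simp
  | add u v hu hv => simp [mul_add, hu, hv]

lemma lapp_mul_tmul_one (φ : A →ₗ[ℂ] ℂ) (x : A) (u : A ⊗[ℂ] A) :
    lapp φ (u * (x ⊗ₜ[ℂ] (1 : A))) = lapp (φ ∘ₗ LinearMap.mulRight ℂ x) u := by
  induction u using TensorProduct.induction_on with
  | zero => simp
  | tmul a b => simp
  | add u v hu hv => simp [add_mul, hu, hv]

lemma rapp_tmul_one_mul (φ : A →ₗ[ℂ] ℂ) (x : A) (u : A ⊗[ℂ] A) :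
    rapp φ ((x ⊗ₜ[ℂ] (1 : A)) * u) = x * rapp φ u := by
  induction u using TensorProduct.induction_on with
  | zero => simp
  | tmul a b => simp
  | add u v hu hv => simp [mul_add, hu, hv]

lemma rapp_one_tmul_mul_comm (φ : A →ₗ[ℂ] ℂ) (x : A) (u : A ⊗[ℂ] A) :
    rapp φ (((1 : A) ⊗ₜ[ℂ] x) * TensorProduct.comm ℂ A A u)
      = lapp (φ ∘ₗ LinearMap.mulLeft ℂ x) u := by
  induction u using TensorProduct.induction_on with
  | zero => simp
  | tmul a b => simp
  | add u v hu hv => simp [mul_add, hu, hv]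

lemma lapp_map_id (φ : A →ₗ[ℂ] ℂ) (f : A →ₗ[ℂ] A) (u : A ⊗[ℂ] A) :
    lapp φ (TensorProduct.map LinearMap.id f u) = f (lapp φ u) := by
  induction u using TensorProduct.induction_on with
  | zero => simp
  | tmul a b => simp
  | add u v hu hv => simp [hu, hv]

lemma lapp_comp (φ : A →ₗ[ℂ] ℂ) (f : A →ₗ[ℂ] A) (u : A ⊗[ℂ] A) :
    lapp (φ ∘ₗ f) u = lapp φ (TensorProduct.map f LinearMap.id u) := by
  induction u using TensorProduct.induction_on with
  | zero => simp
  | tmul a b => simp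
  | add u v hu hv => simp [hu, hv]

end TensorFunctionals

namespace WeakHopfData

variable {A : Type*} [NormedRing A] [StarRing A] [CStarRing A]
  [NormedAlgebra ℂ A] [StarModule ℂ A] [FiniteDimensional ℂ A] (W : WeakHopfData A)

lemma S_one : W.S 1 = 1 := by
  obtain ⟨y, hy⟩ := W.S.surjective 1
  have := W.S_antimul y 1
  rwa [mul_one, hy, mul_one, eq_comm] at this

lemma lapp_ε_Δ (x : A) : lapp W.ε (W.Δ x) = x :=
  LinearMap.congr_fun W.counit_left x

lemma rapp_ε_Δ (x : A) : rapp W.ε (W.Δ x) = x :=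
  LinearMap.congr_fun W.counit_right x

lemma Δ_one_mul (x : A) : W.Δ 1 * W.Δ x = W.Δ x := by rw [← W.Δ_mul, one_mul]

lemma Δ_mul_one (x : A) : W.Δ x * W.Δ 1 = W.Δ x := by rw [← W.Δ_mul, mul_one]

lemma εL_apply (x : A) : W.εL x = lapp (W.ε ∘ₗ LinearMap.mulRight ℂ x) (W.Δ 1) :=
  W.antipode_left x

lemma εR_apply (x : A) : W.εR x = rapp (W.ε ∘ₗ LinearMap.mulLeft ℂ x) (W.Δ 1) :=
  W.antipode_right x

lemma εR_one : W.εR 1 = 1 := by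
  rw [εR_apply, LinearMap.mulLeft_one, LinearMap.comp_id, rapp_ε_Δ]

/-- A representation of `Δ 1` as a sum of pure tensors, together with the two expressions for
`(Δ ⊗ id)(Δ 1)` and `(id ⊗ Δ)(Δ 1)` that it yields. -/
lemma exists_Δ_one_eq_sum : ∃ s : Finset (A × A),
    W.Δ 1 = ∑ i ∈ s, i.1 ⊗ₜ[ℂ] i.2 ∧
    ∑ i ∈ s, W.Δ i.1 ⊗ₜ[ℂ] i.2
      = ∑ i ∈ s, ∑ j ∈ s, (i.1 ⊗ₜ[ℂ] (j.1 * i.2)) ⊗ₜ[ℂ] j.2 ∧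
    ∑ i ∈ s, i.1 ⊗ₜ[ℂ] W.Δ i.2
      = ∑ i ∈ s, ∑ j ∈ s, i.1 ⊗ₜ[ℂ] ((i.2 * j.1) ⊗ₜ[ℂ] j.2) ∧
    ∑ i ∈ s, i.1 ⊗ₜ[ℂ] W.Δ i.2
      = ∑ i ∈ s, ∑ j ∈ s, i.1 ⊗ₜ[ℂ] ((j.1 * i.2) ⊗ₜ[ℂ] j.2) := by
  obtain ⟨s, hs⟩ := TensorProduct.exists_finset (W.Δ 1)
  have hw := W.Δ_one_weak
  have hw' := W.Δ_one_weak'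
  have hc := LinearMap.congr_fun W.coassoc 1
  simp only [LinearMap.comp_apply, LinearEquiv.coe_coe] at hc
  have e1 := hc
  have e2 := hc
  rw [hw] at e1
  rw [hw'] at e2
  simp only [hs, map_sum, TensorProduct.map_tmul, LinearMap.id_apply, TensorProduct.sum_tmul,
    TensorProduct.tmul_sum, TensorProduct.assoc_symm_tmul, TensorProduct.assoc_tmul,
    Finset.sum_mul_sum, Algebra.TensorProduct.tmul_mul_tmul, one_mul, mul_one] at hw' e1 e2
  refine ⟨s, hs, ?_, e1.symm, ?_⟩
  · rw [hw', Finset.sum_comm]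
  · rw [← e2, Finset.sum_comm]

/-- `Δ z = (z ⊗ 1) Δ 1` for `z ∈ A^L`. -/
lemma Δ_εL (x : A) : W.Δ (W.εL x) = (W.εL x ⊗ₜ[ℂ] (1 : A)) * W.Δ 1 := by
  obtain ⟨s, hs, -, h, -⟩ := W.exists_Δ_one_eq_sum
  have := congrArg ((TensorProduct.lid ℂ (A ⊗[ℂ] A)).toLinearMap ∘ₗ
    TensorProduct.map (W.ε ∘ₗ LinearMap.mulRight ℂ x) LinearMap.id) h
  simp only [map_sum, LinearMap.comp_apply, TensorProduct.map_tmul, LinearEquiv.coe_coe,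
    TensorProduct.lid_tmul, LinearMap.id_apply, LinearMap.mulRight_apply] at this
  rw [εL_apply, hs]
  simp only [map_sum, lapp_tmul, map_smul, LinearMap.comp_apply, LinearMap.mulRight_apply, this,
    TensorProduct.sum_tmul, Finset.sum_mul_sum, Algebra.TensorProduct.tmul_mul_tmul, one_mul,
    TensorProduct.smul_tmul', smul_mul_assoc]

/-- `Δ y = (1 ⊗ y) Δ 1` for `y ∈ A^R`. -/
lemma Δ_εR (x : A) : W.Δ (W.εR x) = ((1 : A) ⊗ₜ[ℂ] W.εR x) * W.Δ 1 := by
  obtain ⟨s, hs, h, -, -⟩ := W.exists_Δ_one_eq_sum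
  have := congrArg ((TensorProduct.rid ℂ (A ⊗[ℂ] A)).toLinearMap ∘ₗ
    TensorProduct.map LinearMap.id (W.ε ∘ₗ LinearMap.mulLeft ℂ x)) h
  simp only [map_sum, LinearMap.comp_apply, TensorProduct.map_tmul, LinearEquiv.coe_coe,
    TensorProduct.rid_tmul, LinearMap.id_apply, LinearMap.mulLeft_apply] at this
  rw [εR_apply, hs]
  simp only [map_sum, rapp_tmul, map_smul, LinearMap.comp_apply, LinearMap.mulLeft_apply, this,
    TensorProduct.tmul_sum, Finset.sum_mul_sum, Algebra.TensorProduct.tmul_mul_tmul, one_mul,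
    TensorProduct.tmul_smul, smul_mul_assoc]
  rw [Finset.sum_comm]

/-- `ε^R(x₍₁₎) ⊗ x₍₂₎ = 1₍₁₎ ⊗ x 1₍₂₎`. -/
lemma map_εR_id_Δ (x : A) :
    TensorProduct.map W.εR LinearMap.id (W.Δ x) = ((1 : A) ⊗ₜ[ℂ] x) * W.Δ 1 := by
  obtain ⟨s, hs, -, -, h⟩ := W.exists_Δ_one_eq_sum
  have key : ∀ u : A ⊗[ℂ] A, TensorProduct.map W.εR LinearMap.id (u * W.Δ 1)
      = TensorProduct.map LinearMap.id (lapp W.ε ∘ₗ LinearMap.mulLeft ℂ u)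
        (∑ i ∈ s, i.1 ⊗ₜ[ℂ] W.Δ i.2) := by
    intro u
    rw [h]
    induction u using TensorProduct.induction_on with
    | zero => simp
    | tmul a b =>
      simp only [hs, Finset.mul_sum, map_sum, Algebra.TensorProduct.tmul_mul_tmul,
        TensorProduct.map_tmul, LinearMap.id_apply, LinearMap.comp_apply,
        LinearMap.mulLeft_apply, lapp_tmul, εR_apply, rapp_tmul, TensorProduct.sum_tmul,
        TensorProduct.tmul_smul, TensorProduct.smul_tmul']
      rw [Finset.sum_comm]
      simp only [mul_assoc]
    | add u v hu hv =>
      rw [add_mul, map_add, hu, hv, ← LinearMap.add_apply, ← TensorProduct.map_add_right,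
        ← LinearMap.comp_add]
      congr 3
      ext w
      simp [add_mul]
  have h1 := key (W.Δ x)
  rw [Δ_mul_one] at h1
  rw [h1, hs]
  simp [Finset.mul_sum, ← W.Δ_mul, lapp_ε_Δ]

/-- `x₍₁₎ ⊗ ε^L(x₍₂₎) = 1₍₁₎ x ⊗ 1₍₂₎`. -/
lemma map_id_εL_Δ (x : A) :
    TensorProduct.map LinearMap.id W.εL (W.Δ x) = W.Δ 1 * (x ⊗ₜ[ℂ] (1 : A)) := by
  obtain ⟨s, hs, h, -, -⟩ := W.exists_Δ_one_eq_sum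
  have key : ∀ u : A ⊗[ℂ] A, TensorProduct.map LinearMap.id W.εL (W.Δ 1 * u)
      = TensorProduct.map (rapp W.ε ∘ₗ LinearMap.mulRight ℂ u) LinearMap.id
        (∑ i ∈ s, W.Δ i.1 ⊗ₜ[ℂ] i.2) := by
    intro u
    rw [h]
    induction u using TensorProduct.induction_on with
    | zero => simp
    | tmul a b =>
      simp only [hs, Finset.sum_mul, map_sum, Algebra.TensorProduct.tmul_mul_tmul,
        TensorProduct.map_tmul, LinearMap.id_apply, LinearMap.comp_apply,
        LinearMap.mulRight_apply, rapp_tmul, εL_apply, lapp_tmul, TensorProduct.tmul_sum,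
        TensorProduct.tmul_smul, TensorProduct.smul_tmul', mul_assoc]
    | add u v hu hv =>
      rw [mul_add, map_add, hu, hv, ← LinearMap.add_apply, ← TensorProduct.map_add_left,
        ← LinearMap.comp_add]
      congr 3
      ext w
      simp [mul_add]
  have h1 := key (W.Δ x)
  rw [Δ_one_mul] at h1
  rw [h1, hs]
  simp [Finset.sum_mul, ← W.Δ_mul, rapp_ε_Δ]

lemma εL_εR_mul (y x : A) : W.εL (W.εR y * x) = W.εL x * W.S (W.εR y) := by
  have key : ∀ u : A ⊗[ℂ] A, LinearMap.mul' ℂ A (TensorProduct.map LinearMap.id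
      W.S.toLinearMap (((1 : A) ⊗ₜ[ℂ] W.εR y) * u)) = LinearMap.mul' ℂ A
      (TensorProduct.map LinearMap.id W.S.toLinearMap u) * W.S (W.εR y) := by
    intro u
    induction u using TensorProduct.induction_on with
    | zero => simp
    | tmul a b => simp [W.S_antimul, mul_assoc]
    | add u v hu hv => simp only [mul_add, map_add, hu, hv, add_mul]
  change LinearMap.mul' ℂ A (TensorProduct.map LinearMap.id W.S.toLinearMap (W.Δ _)) = _
  rw [W.Δ_mul, Δ_εR, mul_assoc, Δ_one_mul, key]
  rfl

lemma Δ_one_mul_εR_tmul_one (y : A) :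
    W.Δ 1 * (W.εR y ⊗ₜ[ℂ] (1 : A)) = W.Δ 1 * ((1 : A) ⊗ₜ[ℂ] W.S (W.εR y)) := by
  have key : ∀ u : A ⊗[ℂ] A, TensorProduct.map LinearMap.id W.εL
      (((1 : A) ⊗ₜ[ℂ] W.εR y) * u) = TensorProduct.map LinearMap.id W.εL u
      * ((1 : A) ⊗ₜ[ℂ] W.S (W.εR y)) := by
    intro u
    induction u using TensorProduct.induction_on with
    | zero => simp
    | tmul a b => simp [εL_εR_mul]
    | add u v hu hv => simp only [mul_add, map_add, hu, hv, add_mul]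
  rw [← map_id_εL_Δ, Δ_εR, key, map_id_εL_Δ, ← Algebra.TensorProduct.one_def, mul_one]

lemma S_εR (x : A) : W.S (W.εR x) = W.εL (W.S x) := by
  have key : ∀ u : A ⊗[ℂ] A,
      W.S (LinearMap.mul' ℂ A (TensorProduct.map W.S.toLinearMap LinearMap.id u))
      = LinearMap.mul' ℂ A (TensorProduct.map LinearMap.id W.S.toLinearMap
        (TensorProduct.comm ℂ A A
          (TensorProduct.map W.S.toLinearMap W.S.toLinearMap u))) := by
    intro u
    induction u using TensorProduct.induction_on with
    | zero => simp
    | tmul a b => simp [W.S_antimul]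
    | add u v hu hv => simp only [map_add, hu, hv]
  change W.S (LinearMap.mul' ℂ A (TensorProduct.map W.S.toLinearMap LinearMap.id (W.Δ x)))
    = LinearMap.mul' ℂ A (TensorProduct.map LinearMap.id W.S.toLinearMap (W.Δ (W.S x)))
  rw [key, W.S_anticomul]

lemma exists_S_εR_eq (x : A) : ∃ y, W.S (W.εR y) = W.εL x :=
  ⟨W.S.symm x, by rw [S_εR, LinearEquiv.apply_symm_apply]⟩

/-- `ε^L(x₍₁₎) x₍₂₎ = x`. -/
lemma mul'_map_εL_id_Δ (x : A) :
    LinearMap.mul' ℂ A (TensorProduct.map W.εL LinearMap.id (W.Δ x)) = x := by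
  have key : ∀ u : A ⊗[ℂ] A, LinearMap.mul' ℂ A (TensorProduct.map W.εL LinearMap.id u)
      = lapp W.ε (W.Δ 1 * u) := by
    intro u
    induction u using TensorProduct.induction_on with
    | zero => simp
    | tmul a b =>
      obtain ⟨s, hs⟩ := TensorProduct.exists_finset (W.Δ 1)
      simp [εL_apply, hs, Finset.sum_mul]
    | add u v hu hv => simp only [map_add, hu, hv, mul_add]
  rw [key, Δ_one_mul, lapp_ε_Δ]

/-- `ε^L(x₍₁₎) ⊗ x₍₂₎ = S(1₍₁₎) ⊗ 1₍₂₎ x`. -/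
lemma map_εL_id_Δ (x : A) : TensorProduct.map W.εL LinearMap.id (W.Δ x)
    = TensorProduct.map W.S.toLinearMap LinearMap.id (W.Δ 1) * ((1 : A) ⊗ₜ[ℂ] x) := by
  obtain ⟨s, hs⟩ := TensorProduct.exists_finset (W.Δ 1)
  have hsR : W.Δ 1 = ∑ i ∈ s, W.εR i.1 ⊗ₜ[ℂ] i.2 := by
    have := W.map_εR_id_Δ 1
    rw [← Algebra.TensorProduct.one_def, one_mul] at this
    rw [← this, hs]
    simp
  have key : ∀ u : A ⊗[ℂ] A, TensorProduct.map W.εL LinearMap.id (W.Δ 1 * u)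
      = TensorProduct.map W.S.toLinearMap LinearMap.id (W.Δ 1) *
        ((1 : A) ⊗ₜ[ℂ] LinearMap.mul' ℂ A (TensorProduct.map W.εL LinearMap.id u)) := by
    intro u
    induction u using TensorProduct.induction_on with
    | zero => simp
    | tmul p q =>
      obtain ⟨y, hy⟩ := W.exists_S_εR_eq p
      have h := congrArg (fun v => TensorProduct.map W.S.toLinearMap LinearMap.id v
        * ((1 : A) ⊗ₜ[ℂ] q)) (W.Δ_one_mul_εR_tmul_one y)
      simp only [hy] at h
      rw [hsR] at h ⊢
      simp only [Finset.sum_mul, map_sum, Algebra.TensorProduct.tmul_mul_tmul,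
        TensorProduct.map_tmul, LinearMap.id_apply, LinearMap.mul'_apply, LinearEquiv.coe_coe,
        W.S_antimul, hy, mul_one, εL_εR_mul, mul_assoc] at h ⊢
      exact h
    | add u v hu hv => simp only [mul_add, map_add, hu, hv, TensorProduct.tmul_add]
  have := key (W.Δ x)
  rwa [Δ_one_mul, mul'_map_εL_id_Δ] at this

/-- `S(x₍₁₎) ε^L(x₍₂₎) = S(x)`. -/
lemma mul'_map_S_εL_Δ (x : A) :
    LinearMap.mul' ℂ A (TensorProduct.map W.S.toLinearMap W.εL (W.Δ x)) = W.S x := by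
  have key : ∀ u : A ⊗[ℂ] A, LinearMap.mul' ℂ A (TensorProduct.map W.S.toLinearMap
      LinearMap.id (u * (x ⊗ₜ[ℂ] (1 : A)))) = W.S x * LinearMap.mul' ℂ A
      (TensorProduct.map W.S.toLinearMap LinearMap.id u) := by
    intro u
    induction u using TensorProduct.induction_on with
    | zero => simp
    | tmul a b => simp [W.S_antimul, mul_assoc]
    | add u v hu hv => simp only [mul_add, map_add, hu, hv, add_mul]
  have h : TensorProduct.map W.S.toLinearMap W.εL = TensorProduct.map W.S.toLinearMap
      LinearMap.id ∘ₗ TensorProduct.map LinearMap.id W.εL := by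
    rw [← TensorProduct.map_comp, LinearMap.comp_id, LinearMap.id_comp]
  rw [h, LinearMap.comp_apply, map_id_εL_Δ, key]
  change W.S x * W.εR 1 = _
  rw [εR_one, mul_one]

/-- `ε^R(x₍₁₎) ⊗ x₍₂₎ = (S(x₍₁₎) ⊗ 1) Δ(x₍₂₎)`. -/
lemma map_εR_id_Δ_eq (x : A) : TensorProduct.map W.εR LinearMap.id (W.Δ x)
    = LinearMap.mul' ℂ (A ⊗[ℂ] A) (TensorProduct.map
      ((TensorProduct.mk ℂ A A).flip 1 ∘ₗ W.S.toLinearMap) W.Δ (W.Δ x)) := by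
  have hc := congrArg (LinearMap.mul' ℂ (A ⊗[ℂ] A) ∘ₗ TensorProduct.map
      ((TensorProduct.mk ℂ A A).flip 1 ∘ₗ W.S.toLinearMap) LinearMap.id)
      (LinearMap.congr_fun W.coassoc x)
  have key : ∀ (w : A ⊗[ℂ] A) (q : A), (LinearMap.mul' ℂ (A ⊗[ℂ] A) ∘ₗ TensorProduct.map
      ((TensorProduct.mk ℂ A A).flip 1 ∘ₗ W.S.toLinearMap) LinearMap.id)
      (TensorProduct.assoc ℂ A A A (w ⊗ₜ[ℂ] q))
      = LinearMap.mul' ℂ A (TensorProduct.map W.S.toLinearMap LinearMap.id w) ⊗ₜ[ℂ] q := by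
    intro w q
    induction w using TensorProduct.induction_on with
    | zero => simp
    | tmul a b => simp
    | add u v hu hv => simp only [TensorProduct.add_tmul, map_add, hu, hv]
  obtain ⟨t, ht⟩ := TensorProduct.exists_finset (W.Δ x)
  simp only [LinearMap.comp_apply, ht, map_sum] at hc ⊢
  simp only [TensorProduct.map_tmul, LinearMap.id_apply, LinearEquiv.coe_coe] at hc ⊢
  simp only [LinearMap.comp_apply] at key
  simp only [key] at hc
  exact hc

end WeakHopfData

namespace HaarPkg

variable {A : Type*} [NormedRing A] [StarRing A] [CStarRing A]
  [NormedAlgebra ℂ A] [StarModule ℂ A] [FiniteDimensional ℂ A] (P : HaarPkg A)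

/-- `h₍₁₎ ⊗ x h₍₂₎ = S(x) h₍₁₎ ⊗ h₍₂₎`. -/
lemma one_tmul_mul_Δ_h (x : A) :
    ((1 : A) ⊗ₜ[ℂ] x) * P.W.Δ P.h = (P.W.S x ⊗ₜ[ℂ] (1 : A)) * P.W.Δ P.h := by
  have key : ∀ u : A ⊗[ℂ] A, LinearMap.mul' ℂ (A ⊗[ℂ] A) (TensorProduct.map
      ((TensorProduct.mk ℂ A A).flip 1 ∘ₗ P.W.S.toLinearMap) P.W.Δ u) * P.W.Δ P.h
      = (LinearMap.mul' ℂ A (TensorProduct.map P.W.S.toLinearMap P.W.εL u) ⊗ₜ[ℂ] (1 : A))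
        * P.W.Δ P.h := by
    intro u
    induction u using TensorProduct.induction_on with
    | zero => simp
    | tmul a b =>
      simp only [TensorProduct.map_tmul, LinearMap.mul'_apply, LinearMap.comp_apply,
        LinearMap.flip_apply, TensorProduct.mk_apply, mul_assoc, ← P.W.Δ_mul, P.haar_left b]
      rw [P.W.Δ_mul, P.W.Δ_εL, mul_assoc, P.W.Δ_one_mul, ← mul_assoc,
        Algebra.TensorProduct.tmul_mul_tmul, one_mul]
    | add u v hu hv => simp only [map_add, hu, hv, add_mul, TensorProduct.add_tmul]
  rw [← P.W.Δ_one_mul P.h, ← mul_assoc, ← P.W.map_εR_id_Δ, P.W.map_εR_id_Δ_eq, key,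
    P.W.mul'_map_S_εL_Δ, P.W.Δ_one_mul]

/-- `h₍₁₎ x ⊗ h₍₂₎ = h₍₁₎ ⊗ h₍₂₎ S(x)`. -/
lemma Δ_h_mul_tmul_one (x : A) :
    P.W.Δ P.h * (x ⊗ₜ[ℂ] (1 : A)) = P.W.Δ P.h * ((1 : A) ⊗ₜ[ℂ] P.W.S x) := by
  obtain ⟨y, rfl⟩ := P.W.S.surjective x
  have hS := P.W.S_anticomul P.h
  rw [P.haar_S] at hS
  have key : ∀ (a b : A) (u : A ⊗[ℂ] A), TensorProduct.comm ℂ A A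
      (TensorProduct.map P.W.S.toLinearMap P.W.S.toLinearMap ((a ⊗ₜ[ℂ] b) * u))
      = TensorProduct.comm ℂ A A (TensorProduct.map P.W.S.toLinearMap P.W.S.toLinearMap u)
        * (P.W.S b ⊗ₜ[ℂ] P.W.S a) := by
    intro a b u
    induction u using TensorProduct.induction_on with
    | zero => simp
    | tmul c d => simp [P.W.S_antimul]
    | add u v hu hv => simp only [mul_add, map_add, hu, hv, add_mul]
  have h := congrArg (fun u => TensorProduct.comm ℂ A A
    (TensorProduct.map P.W.S.toLinearMap P.W.S.toLinearMap u)) (P.one_tmul_mul_Δ_h y)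
  simpa only [key, ← hS, P.W.S_one] using h

lemma gL_mul_inverse : P.gL * Ring.inverse P.gL = 1 := Ring.mul_inverse_cancel _ P.gL_unit

lemma inverse_gL_mul : Ring.inverse P.gL * P.gL = 1 := Ring.inverse_mul_cancel _ P.gL_unit

lemma inverse_gR_mul : Ring.inverse P.gR * P.gR = 1 := Ring.inverse_mul_cancel _ P.gR_unit

lemma commute_gL_inverse_gR : Commute P.gL (Ring.inverse P.gR) := by
  obtain ⟨u, hu⟩ := P.gR_unit
  rw [← hu, Ring.inverse_unit]
  exact Commute.units_inv_right (show Commute P.gL u from hu ▸ P.gLR_comm)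

lemma inverse_gL_commute_gR : Commute (Ring.inverse P.gL) P.gR := by
  obtain ⟨u, hu⟩ := P.gL_unit
  rw [← hu, Ring.inverse_unit]
  exact Commute.units_inv_left (show Commute (u : A) P.gR from hu ▸ P.gLR_comm)

lemma inverse_gL_commute_inverse_gR : Commute (Ring.inverse P.gL) (Ring.inverse P.gR) := by
  obtain ⟨u, hu⟩ := P.gL_unit
  rw [← hu, Ring.inverse_unit]
  exact Commute.units_inv_left (hu ▸ P.commute_gL_inverse_gR)

lemma inverse_g : Ring.inverse (P.gL * Ring.inverse P.gR) = P.gR * Ring.inverse P.gL := by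
  rw [Ring.mul_inverse_rev' P.commute_gL_inverse_gR,
    Ring.inverse_inverse P.gR_unit]

lemma S_gR : P.W.S P.gR = P.gL := by
  rw [P.gR_S, P.S_sq, inverse_g, P.commute_gL_inverse_gR.eq, mul_assoc, mul_assoc,
    ← mul_assoc P.gL P.gR, P.gLR_comm, mul_assoc P.gR, P.gL_mul_inverse, mul_one,
    P.gLR_comm, ← mul_assoc, P.inverse_gR_mul, one_mul]

lemma S_inverse_gL : P.W.S (Ring.inverse P.gL) = Ring.inverse P.gR := by
  have h : P.gR * P.W.S (Ring.inverse P.gL) = 1 := by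
    rw [P.gR_S, ← P.W.S_antimul, P.inverse_gL_mul, P.W.S_one]
  rw [← one_mul (P.W.S _), ← P.inverse_gR_mul, mul_assoc, h, mul_one]

lemma S_inverse_gR : P.W.S (Ring.inverse P.gR) = Ring.inverse P.gL := by
  have h : P.gL * P.W.S (Ring.inverse P.gR) = 1 := by
    rw [← P.S_gR, ← P.W.S_antimul, P.inverse_gR_mul, P.W.S_one]
  rw [← one_mul (P.W.S _), ← P.inverse_gL_mul, mul_assoc, h, mul_one]

/-- The modular automorphism of `ĥ` is implemented by `gL gR`. -/
lemma hHat_mul (x a : A) : P.hHat (x * a)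
    = P.hHat (a * (P.gL * P.gR * x * (Ring.inverse P.gL * Ring.inverse P.gR))) := by
  set y := P.gL * P.gR * x * (Ring.inverse P.gL * Ring.inverse P.gR) with hy
  have h₁ : (P.gL * Ring.inverse P.gR) * (lapp (P.hHat ∘ₗ LinearMap.mulLeft ℂ x) (P.W.Δ P.h)
      * (P.gL * Ring.inverse P.gR)) = P.W.S x * (P.gL * P.gL) := by
    have hf : P.W.Δ P.h = TensorProduct.comm ℂ A A (TensorProduct.comm ℂ A A (P.W.Δ P.h)) :=
      (LinearEquiv.symm_apply_apply (TensorProduct.comm ℂ A A) _).symm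
    rw [P.gL_sq, ← rapp_tmul_one_mul, ← P.one_tmul_mul_Δ_h, hf, rapp_one_tmul_mul_comm, ← hf,
      ← P.haar_flip, lapp_map_id]
    rfl
  have h₂ : lapp (P.hHat ∘ₗ LinearMap.mulRight ℂ y) (P.W.Δ P.h)
      = P.gR * P.gR * P.W.S y := by
    rw [P.gR_sq, ← lapp_mul_tmul_one, P.Δ_h_mul_tmul_one, lapp_mul_one_tmul]
  have h₃ : (P.gL * Ring.inverse P.gR) * (P.gR * P.gR * P.W.S y * (P.gL * Ring.inverse P.gR))
      = P.W.S x * (P.gL * P.gL) := by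
    simp only [hy, P.W.S_antimul, P.S_inverse_gL, P.S_inverse_gR, P.S_gR, ← P.gR_S]
    simp only [mul_assoc, P.commute_gL_inverse_gR.left_comm,
      Ring.inverse_mul_cancel_left _ _ P.gR_unit, Ring.mul_inverse_cancel_left _ _ P.gL_unit,
      ← P.inverse_gL_commute_gR.left_comm, Ring.mul_inverse_cancel_left _ _ P.gR_unit]
    rw [P.commute_gL_inverse_gR.eq, Ring.mul_inverse_cancel_left _ _ P.gR_unit]
  have h₄ : lapp (P.hHat ∘ₗ LinearMap.mulLeft ℂ x) (P.W.Δ P.h)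
      = lapp (P.hHat ∘ₗ LinearMap.mulRight ℂ y) (P.W.Δ P.h) := by
    rw [h₂]
    exact P.g_unit.mul_right_cancel (P.g_unit.mul_left_cancel (h₁.trans h₃.symm))
  obtain ⟨-, ψ, -, rfl⟩ := P.haar_nondeg a
  have h₅ := congrArg ψ h₄
  rwa [← apply_rapp_eq_apply_lapp, ← apply_rapp_eq_apply_lapp] at h₅

lemma jayEl_eq : P.jayEl = lapp P.hHat
    (((Ring.inverse P.gL * Ring.inverse P.gL) ⊗ₜ[ℂ] (1 : A)) * P.W.Δ 1) := by
  obtain ⟨x, hx⟩ := P.gL_mem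
  have hL : P.W.Δ P.gL = (P.gL ⊗ₜ[ℂ] (1 : A)) * P.W.Δ 1 := by rw [← hx, P.W.Δ_εL]
  have hLi : P.W.Δ (Ring.inverse P.gL) = (Ring.inverse P.gL ⊗ₜ[ℂ] (1 : A)) * P.W.Δ 1 := by
    have h : P.W.Δ 1 = (P.gL ⊗ₜ[ℂ] (1 : A)) * P.W.Δ (Ring.inverse P.gL) := by
      rw [← P.W.Δ_one_mul (Ring.inverse P.gL), ← mul_assoc, ← hL, ← P.W.Δ_mul,
        P.gL_mul_inverse]
    rw [h, ← mul_assoc, Algebra.TensorProduct.tmul_mul_tmul, P.inverse_gL_mul, one_mul,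
      ← Algebra.TensorProduct.one_def, one_mul]
  rw [jayEl, P.W.Δ_mul, hLi, mul_assoc, ← hLi, P.W.Δ_one_mul, hLi, ← mul_assoc,
    Algebra.TensorProduct.tmul_mul_tmul, one_mul]

/-- `⟨ĥ, ε^L(x) gR⁻²⟩ = ⟨ĥ, gL⁻² ε^R(x)⟩`. -/
lemma hHat_εL_mul (x : A) : P.hHat (P.W.εL x * (Ring.inverse P.gR * Ring.inverse P.gR))
    = P.hHat (Ring.inverse P.gL * Ring.inverse P.gL * P.W.εR x) := by
  have key : ∀ u : A ⊗[ℂ] A, P.hHat (LinearMap.mul' ℂ A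
      (TensorProduct.map LinearMap.id P.W.S.toLinearMap u)
        * (Ring.inverse P.gR * Ring.inverse P.gR))
      = P.hHat (Ring.inverse P.gL * Ring.inverse P.gL * LinearMap.mul' ℂ A
        (TensorProduct.map P.W.S.toLinearMap LinearMap.id u)) := by
    intro u
    induction u using TensorProduct.induction_on with
    | zero => simp
    | tmul p q =>
      simp only [TensorProduct.map_tmul, LinearMap.mul'_apply, LinearMap.id_apply,
        LinearEquiv.coe_coe]
      rw [← P.hHat_S (_ * (P.W.S p * q)), mul_assoc p, P.hHat_mul]
      simp only [P.W.S_antimul, P.S_inverse_gL, P.S_sq, P.inverse_g]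
      have hl : Ring.inverse P.gR * (Ring.inverse P.gR * (P.gL * P.gR))
          = P.gL * Ring.inverse P.gR := by
        rw [P.gLR_comm, Ring.inverse_mul_cancel_left _ _ P.gR_unit,
          P.commute_gL_inverse_gR.eq]
      have hr : P.gR * (Ring.inverse P.gL * (Ring.inverse P.gR * Ring.inverse P.gR))
          = Ring.inverse P.gL * Ring.inverse P.gR := by
        rw [← P.inverse_gL_commute_gR.left_comm, Ring.mul_inverse_cancel_left _ _ P.gR_unit]
      rw [← hr]
      congr 1
      have hl' := congrArg (fun z => P.W.S q * z *
        (p * (P.gR * (Ring.inverse P.gL * (Ring.inverse P.gR * Ring.inverse P.gR))))) hl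
      simp only [mul_assoc] at hl' ⊢
      exact hl'

    | add u v hu hv => simp only [map_add, hu, hv, mul_add, add_mul]
  exact key (P.W.Δ x)

lemma jayEl_mul_comm (x : A) : P.jayEl * x = x * P.jayEl := by
  set φ : A →ₗ[ℂ] ℂ :=
    P.hHat ∘ₗ LinearMap.mulLeft ℂ (Ring.inverse P.gL * Ring.inverse P.gL) with hφ
  set ψ : A →ₗ[ℂ] ℂ :=
    P.hHat ∘ₗ LinearMap.mulRight ℂ (Ring.inverse P.gR * Ring.inverse P.gR) with hψ
  have hψφ : ψ ∘ₗ P.W.εL = φ ∘ₗ P.W.εR := LinearMap.ext fun y => P.hHat_εL_mul y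
  have hψS : ψ ∘ₗ P.W.S.toLinearMap = φ := LinearMap.ext fun y => by
    simp only [hφ, hψ, LinearMap.comp_apply, LinearEquiv.coe_coe, LinearMap.mulLeft_apply,
      LinearMap.mulRight_apply]
    rw [← P.hHat_S (_ * y), P.W.S_antimul, P.W.S_antimul, P.S_inverse_gL]
  have hj : P.jayEl = lapp φ (P.W.Δ 1) := by rw [jayEl_eq, lapp_tmul_one_mul]
  have h := congrArg (fun χ => lapp χ (P.W.Δ x)) hψφ
  simpa only [lapp_comp _ P.W.εL, lapp_comp _ P.W.εR, P.W.map_εL_id_Δ, P.W.map_εR_id_Δ,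
    lapp_mul_one_tmul, lapp_one_tmul_mul, ← lapp_comp, hψS, ← hj] using h

end HaarPkg

/-- **The functional `ω` is tracial.**
`⟨ĥ, ȷ⁻¹ gL⁻¹ gR⁻¹ x⟩ = ⟨ĥ, x ȷ⁻¹ gL⁻¹ gR⁻¹⟩` for all `x`, and the functional
`⟨ω, x⟩ := ⟨ĥ, ȷ⁻¹ gL⁻¹ gR⁻¹ x⟩` satisfies `⟨ω, x y⟩ = ⟨ω, y x⟩`. -/
theorem HaarPkg.omegaFunctional_tracial {A : Type*} [NormedRing A] [StarRing A] [CStarRing A]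
    [NormedAlgebra ℂ A] [StarModule ℂ A] [FiniteDimensional ℂ A]
    (P : HaarPkg A) :
    (∀ x : A,
      P.hHat (Ring.inverse P.jayEl * (Ring.inverse P.gL * Ring.inverse P.gR) * x)
        = P.hHat (x * (Ring.inverse P.jayEl * (Ring.inverse P.gL * Ring.inverse P.gR)))) ∧
    (∀ x y : A, P.ω (x * y) = P.ω (y * x)) := by
  set m := Ring.inverse P.jayEl * (Ring.inverse P.gL * Ring.inverse P.gR) with hm
  have hj (x : A) : Ring.inverse P.jayEl * x = x * Ring.inverse P.jayEl := by
    by_cases hu : IsUnit P.jayEl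
    · obtain ⟨u, hu⟩ := hu
      rw [← hu, Ring.inverse_unit]
      exact Commute.units_inv_left (show Commute (u : A) x from hu ▸ P.jayEl_mul_comm x)
    · simp [Ring.inverse_non_unit _ hu]
  have hk : P.gL * P.gR * m = Ring.inverse P.jayEl := by
    rw [hm, ← mul_assoc, ← hj, mul_assoc]
    have h : P.gL * (P.gR * (Ring.inverse P.gL * Ring.inverse P.gR)) = 1 := by
      rw [P.inverse_gL_commute_inverse_gR.eq, Ring.mul_inverse_cancel_left _ _ P.gR_unit,
        P.gL_mul_inverse]
    rw [mul_assoc P.gL, h, mul_one]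
  have h₁ (x : A) : P.hHat (m * x) = P.hHat (x * m) := by
    rw [P.hHat_mul, hk]
  refine ⟨h₁, fun x y => ?_⟩
  change P.hHat (m * (x * y)) = P.hHat (m * (y * x))
  rw [h₁ (y * x), ← mul_assoc, P.hHat_mul, ← mul_assoc (P.gL * P.gR), hk, hj, hm]
  simp only [mul_assoc]

end
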